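/- arXiv:2006.11896 — 2 statements merged into one kernel-verified Lean document; each statement's English description precedes it below -/
import Mathlib

section
/- Let m ≥ 1 be an integer and 1 < r < ∞, r' = r/(r−1). There is a constant C (depending only on n, m, r) such that for every weight σ on ℝⁿ, every cube Q with σ(Q) > 0, and every measurable f ≥ 0: ‖fσ‖_{L(log L)^m,Q} ≤ C·‖σ‖_{L(log L)^{mr'},Q}^{1/r'}·(σ_Q)^{1/r}·‖f‖^σ_{L^r,Q}, where ‖f‖^σ_{L^r,Q} = ((1/σ(Q))∫_Q f^r σ)^{1/r}. -/
open MeasureTheory ENNReal Filter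

noncomputable section

/-- A (half-open) cube in `ℝⁿ`. -/
structure Cube (n : ℕ) where
  corner : Fin n → ℝ
  side : ℝ
  side_pos : 0 < side

/-- The underlying set of a cube. -/
def Cube.set {n : ℕ} (Q : Cube n) : Set (Fin n → ℝ) :=
  Set.univ.pi fun i => Set.Ico (Q.corner i) (Q.corner i + Q.side)

/-- A weight: a non-negative, locally integrable function. -/
def IsWeight {n : ℕ} (w : (Fin n → ℝ) → ℝ) : Prop :=
  Measurable w ∧ (∀ x, 0 ≤ w x) ∧ LocallyIntegrable w volume

/-- A sparse family of cubes with sparseness constant `α`. -/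
def IsSparse {n : ℕ} (S : Set (Cube n)) (α : ℝ) : Prop :=
  ∃ E : Cube n → Set (Fin n → ℝ),
    (∀ Q ∈ S, E Q ⊆ Q.set ∧ MeasurableSet (E Q) ∧
      ENNReal.ofReal α * volume Q.set ≤ volume (E Q)) ∧
    S.Pairwise fun Q Q' => Disjoint (E Q) (E Q')

/-- The normalized Luxemburg norm `‖f‖_{φ,Q}` (with value `∞` if no λ works). -/
def luxNorm {n : ℕ} (φ : ℝ → ℝ) (Q : Set (Fin n → ℝ)) (f : (Fin n → ℝ) → ℝ) : ℝ≥0∞ :=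
  sInf {l : ℝ≥0∞ | ∃ c : ℝ, 0 < c ∧ l = ENNReal.ofReal c ∧
    (∫⁻ x in Q, ENNReal.ofReal (φ (|f x| / c))) ≤ volume Q}

/-- The sparse Orlicz operator `A_{L(log L)^m, S}`. -/
def sparseOrlicz {n : ℕ} (m : ℕ) (S : Set (Cube n)) (f : (Fin n → ℝ) → ℝ)
    (x : Fin n → ℝ) : ℝ≥0∞ :=
  ∑' Q : S, luxNorm (fun t => t * Real.log (Real.exp 1 + t) ^ m) Q.1.set f *
    Set.indicator Q.1.set (fun _ => (1 : ℝ≥0∞)) x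

/-- `L^p(w)` norm of an `ℝ≥0∞`-valued function. -/
def lpNormW {n : ℕ} (p : ℝ) (w : (Fin n → ℝ) → ℝ) (g : (Fin n → ℝ) → ℝ≥0∞) : ℝ≥0∞ :=
  (∫⁻ x, g x ^ p * ENNReal.ofReal (w x)) ^ (1 / p)

/-- `L^p(w)` norm of a real-valued function. -/
def lpNormR {n : ℕ} (p : ℝ) (w f : (Fin n → ℝ) → ℝ) : ℝ≥0∞ :=
  (∫⁻ x, ENNReal.ofReal |f x| ^ p * ENNReal.ofReal (w x)) ^ (1 / p)

/-- The two-weight bump constant `[g,h]_{A,B}`. -/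
def bump {n : ℕ} (A B : ℝ → ℝ) (g h : (Fin n → ℝ) → ℝ) : ℝ≥0∞ :=
  ⨆ Q : Cube n, luxNorm A Q.set g * luxNorm B Q.set h

/-- The logarithmic-bump Young function `t ↦ t^q (log(e+t))^a`. -/
def phiLog (q a : ℝ) : ℝ → ℝ := fun t => t ^ q * Real.log (Real.exp 1 + t) ^ a

/-- Average of a function over a cube. -/
def cubeAvg {n : ℕ} (w : (Fin n → ℝ) → ℝ) (Q : Cube n) : ℝ :=
  (∫ x in Q.set, w x) / (volume Q.set).toReal

lemma one_le_log_exp_one_add {x : ℝ} (hx : 0 ≤ x) : 1 ≤ Real.log (Real.exp 1 + x) := by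
  rw [Real.le_log_iff_exp_le (by positivity)]
  linarith

lemma log_exp_one_add_mono {x y : ℝ} (hx : 0 ≤ x) (hxy : x ≤ y) :
    Real.log (Real.exp 1 + x) ≤ Real.log (Real.exp 1 + y) :=
  Real.log_le_log (by positivity) (by linarith)

lemma log_exp_one_add_rpow_le {x k : ℝ} (hx : 0 ≤ x) (hk : 1 ≤ k) :
    Real.log (Real.exp 1 + x ^ k) ≤ k * Real.log (Real.exp 1 + x) := by
  rw [← Real.log_rpow (by positivity)]
  refine Real.log_le_log (by positivity) ?_
  have h := Real.add_rpow_le_rpow_add (Real.exp_pos 1).le hx hk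
  have h1 : Real.exp 1 ≤ Real.exp 1 ^ k :=
    Real.self_le_rpow_of_one_le (Real.one_le_exp zero_le_one) hk
  linarith

lemma log_exp_one_add_one_add_le {x : ℝ} (hx : 0 ≤ x) :
    Real.log (Real.exp 1 + (1 + x)) ≤ 2 * Real.log (Real.exp 1 + x) := by
  rw [show 2 * Real.log (Real.exp 1 + x) = Real.log ((Real.exp 1 + x) ^ 2) by
    rw [Real.log_pow]; norm_num]
  refine Real.log_le_log (by positivity) ?_
  nlinarith [Real.add_one_le_exp 1]

lemma log_exp_one_add_le_rpow {x ε : ℝ} (hx : 1 ≤ x) (hε : 0 < ε) :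
    Real.log (Real.exp 1 + x) ≤ 4 ^ ε / ε * x ^ ε := by
  have h3 : Real.exp 1 ≤ 3 := by linarith [Real.exp_one_lt_d9]
  calc Real.log (Real.exp 1 + x) ≤ (Real.exp 1 + x) ^ ε / ε :=
        Real.log_le_rpow_div (by positivity) hε
    _ ≤ (4 * x) ^ ε / ε := by gcongr; linarith
    _ = 4 ^ ε / ε * x ^ ε := by
        rw [Real.mul_rpow (by norm_num) (by linarith)]; ring

/-- Young's inequality without the sharp constants. -/
lemma mul_le_rpow_add_rpow {a b p q : ℝ} (ha : 0 ≤ a) (hb : 0 ≤ b) (h : p.HolderConjugate q) :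
    a * b ≤ a ^ p + b ^ q := by
  refine (Real.young_inequality_of_nonneg ha hb h).trans (add_le_add ?_ ?_)
  · exact div_le_self (by positivity) h.lt.le
  · exact div_le_self (by positivity) h.symm.lt.le

/-- A Young-type inequality for the triple `t log^m (e + t)`, `t ^ r`,
`t ^ p log^(m p) (e + t)`. -/
lemma exists_mul_log_pow_le {m : ℕ} (hm : 1 ≤ m) {r p : ℝ} (h : r.HolderConjugate p) :
    ∃ C : ℝ, 1 ≤ C ∧ ∀ g k : ℝ, 0 ≤ g → 0 ≤ k →
      g * k * Real.log (Real.exp 1 + g * k) ^ m ≤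
        C * (g ^ r + k ^ p * Real.log (Real.exp 1 + k) ^ (m * p)) := by
  have hr := h.lt
  have hp := h.symm.lt
  have hm0 : (0 : ℝ) < m := by exact_mod_cast hm
  set δ : ℝ := (r - 1) / 2 with hδ
  have hδ0 : 0 < δ := by rw [hδ]; linarith
  set a : ℝ := 1 + 1 / δ with ha
  have ha1 : 1 ≤ a := by rw [ha]; linarith [one_div_pos.2 hδ0]
  set b : ℝ := 1 + δ with hb
  have hb1 : 1 ≤ b := by rw [hb]; linarith
  set ε : ℝ := δ / m with hε
  have hε0 : 0 < ε := by positivity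
  set D : ℝ := 4 ^ ε / ε with hD
  have hD0 : 0 < D := by positivity
  have hmain : ∀ g k : ℝ, 0 ≤ g → 0 ≤ k →
      g * k * Real.log (Real.exp 1 + g * k) ^ m ≤
        (a ^ (m * p) + (2 * b) ^ m + (b * D) ^ m + 1) *
          (g ^ r + k ^ p * Real.log (Real.exp 1 + k) ^ (m * p)) := by
    intro g k hg hk
    have hlk := one_le_log_exp_one_add hk
    have hlgk := one_le_log_exp_one_add (mul_nonneg hg hk)
    have hlg := one_le_log_exp_one_add hg
    set l := Real.log (Real.exp 1 + k) with hl
    set L := Real.log (Real.exp 1 + g * k) with hL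
    have hl1 : 1 ≤ l ^ (m * p) := Real.one_le_rpow hlk (by positivity)
    have hX : 0 ≤ g ^ r := by positivity
    have hY : 0 ≤ k ^ p * l ^ (m * p) := by positivity
    have hkY : k ^ p ≤ k ^ p * l ^ (m * p) := le_mul_of_one_le_right (by positivity) hl1
    have hA1 : 1 ≤ a ^ (m * p) := Real.one_le_rpow ha1 (by positivity)
    have hB0 : 0 ≤ (2 * b) ^ m := by positivity
    have hE0 : 0 ≤ (b * D) ^ m := by positivity
    rcases le_or_gt (g ^ δ) k with hgk | hgk
    · have hgk' : g * k ≤ k ^ a := by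
        have h1 : g ≤ k ^ (1 / δ) := by
          have := Real.rpow_le_rpow (by positivity) hgk (by positivity : 0 ≤ 1 / δ)
          rwa [← Real.rpow_mul hg, mul_one_div_cancel hδ0.ne', Real.rpow_one] at this
        calc g * k ≤ k ^ (1 / δ) * k := by gcongr
          _ = k ^ a := by
            rw [ha, Real.rpow_add_of_nonneg hk (by norm_num) (by positivity), Real.rpow_one]
            ring
      have hLl : L ≤ a * l :=
        (log_exp_one_add_mono (by positivity) hgk').trans (log_exp_one_add_rpow_le hk ha1)
      have hLm : (L ^ m) ^ p ≤ a ^ (m * p) * l ^ (m * p) := by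
        rw [← Real.rpow_natCast, ← Real.rpow_mul (by linarith),
          ← Real.mul_rpow (by linarith) (by linarith)]
        gcongr
      calc g * k * L ^ m = g * (k * L ^ m) := by ring
        _ ≤ g ^ r + (k * L ^ m) ^ p := mul_le_rpow_add_rpow hg (by positivity) h
        _ = g ^ r + k ^ p * (L ^ m) ^ p := by rw [Real.mul_rpow hk (by positivity)]
        _ ≤ g ^ r + k ^ p * (a ^ (m * p) * l ^ (m * p)) := by gcongr
        _ = g ^ r + a ^ (m * p) * (k ^ p * l ^ (m * p)) := by ring
        _ ≤ _ := by nlinarith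
    · have hgk' : g * k ≤ g ^ b := by
        calc g * k ≤ g * g ^ δ := by gcongr
          _ = g ^ b := by
            rw [hb, Real.rpow_add_of_nonneg hg (by norm_num) hδ0.le, Real.rpow_one]
      have hLl : L ≤ b * Real.log (Real.exp 1 + g) :=
        (log_exp_one_add_mono (by positivity) hgk').trans (log_exp_one_add_rpow_le hg hb1)
      rcases le_or_gt g 1 with hg1 | hg1
      · have h2 : Real.log (Real.exp 1 + g) ≤ 2 := by
          have h3 := log_exp_one_add_one_add_le le_rfl
          have h4 := log_exp_one_add_mono hg (by linarith : g ≤ 1 + 0)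
          simp at h3 h4
          linarith
        have hL2 : L ≤ 2 * b := by nlinarith
        calc g * k * L ^ m ≤ (g ^ r + k ^ p) * (2 * b) ^ m := by
              gcongr
              exact mul_le_rpow_add_rpow hg hk h
          _ ≤ (g ^ r + k ^ p * l ^ (m * p)) * (2 * b) ^ m := by gcongr
          _ ≤ _ := by nlinarith
      · have hL2 : L ≤ b * D * g ^ ε := by
          have := log_exp_one_add_le_rpow hg1.le hε0
          calc L ≤ b * Real.log (Real.exp 1 + g) := hLl
            _ ≤ b * (D * g ^ ε) := by gcongr
            _ = _ := by ring
        calc g * k * L ^ m ≤ g ^ b * (b * D * g ^ ε) ^ m := by gcongr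
          _ = (b * D) ^ m * (g ^ b * (g ^ ε) ^ m) := by rw [mul_pow]; ring
          _ = (b * D) ^ m * g ^ r := by
            rw [← Real.rpow_natCast (g ^ ε) m, ← Real.rpow_mul hg, ← Real.rpow_add (by linarith)]
            congr 2
            rw [hε, hb, hδ]
            field_simp
            ring
          _ ≤ _ := by nlinarith
  exact ⟨_, by linarith [show 0 ≤ a ^ (m * p) + (2 * b) ^ m + (b * D) ^ m by positivity], hmain⟩

lemma exists_rpow_mul_rpow_mul_log_pow_le {m : ℕ} (hm : 1 ≤ m) {r p : ℝ}
    (h : r.HolderConjugate p) :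
    ∃ C : ℝ, 1 ≤ C ∧ ∀ u w : ℝ, 0 ≤ u → 0 ≤ w →
      u ^ (1 / r) * w ^ (1 / p) * Real.log (Real.exp 1 + u ^ (1 / r) * w ^ (1 / p)) ^ m ≤
        C * (u + w * Real.log (Real.exp 1 + w) ^ (m * p)) := by
  obtain ⟨C, hC, hmain⟩ := exists_mul_log_pow_le hm h
  have hr := h.lt
  have hp := h.symm.lt
  have h2 : (1 : ℝ) ≤ 2 ^ (m * p) := Real.one_le_rpow (by norm_num) (by positivity)
  refine ⟨C * 2 ^ (m * p), by nlinarith, fun u w hu hw => ?_⟩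
  have key := hmain (u ^ (1 / r)) (w ^ (1 / p)) (by positivity) (by positivity)
  rw [← Real.rpow_mul hu, ← Real.rpow_mul hw, one_div_mul_cancel (by linarith),
    one_div_mul_cancel (by linarith), Real.rpow_one, Real.rpow_one] at key
  have hlw := one_le_log_exp_one_add hw
  have hw1 : w ^ (1 / p) ≤ 1 + w := by
    rcases le_or_gt w 1 with hw1 | hw1
    · linarith [Real.rpow_le_one hw hw1 (by positivity : 0 ≤ 1 / p)]
    · have := Real.rpow_le_rpow_of_exponent_le hw1.le ((div_le_one (by linarith)).2 hp.le)
      rw [Real.rpow_one] at this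
      linarith
  have hl := (log_exp_one_add_mono (by positivity) hw1).trans (log_exp_one_add_one_add_le hw)
  have hl0 := one_le_log_exp_one_add (by positivity : 0 ≤ w ^ (1 / p))
  calc _ ≤ _ := key
    _ ≤ C * (2 ^ (m * p) * u + w * (2 * Real.log (Real.exp 1 + w)) ^ (m * p)) := by
      gcongr
      exact le_mul_of_one_le_left hu h2
    _ = _ := by
      rw [Real.mul_rpow (by norm_num) (by linarith)]
      ring

lemma Cube.volume_set {n : ℕ} (Q : Cube n) : volume Q.set = ENNReal.ofReal (Q.side ^ n) := by
  simp [Cube.set, ENNReal.ofReal_pow Q.side_pos.le, volume_pi_pi]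

lemma Cube.measurableSet_set {n : ℕ} (Q : Cube n) : MeasurableSet Q.set :=
  MeasurableSet.univ_pi fun _ => measurableSet_Ico

lemma luxNorm_eq_zero_of_ae {n : ℕ} {φ : ℝ → ℝ} (hφ : φ 0 = 0) {Q : Set (Fin n → ℝ)}
    {f : (Fin n → ℝ) → ℝ} (hf : ∀ᵐ x ∂volume.restrict Q, f x = 0) : luxNorm φ Q f = 0 := by
  refine le_antisymm (le_of_forall_gt fun b hb => ?_) zero_le
  obtain ⟨c, hc0, hcb⟩ := ENNReal.lt_iff_exists_nnreal_btwn.1 hb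
  refine lt_of_le_of_lt (sInf_le ⟨c, by exact_mod_cast hc0, by simp, ?_⟩) hcb
  rw [lintegral_congr_ae (g := fun _ => 0)]
  · simp
  · filter_upwards [hf] with x hx
    simp [hx, hφ]

/-- The average of `|f|` is dominated by its Luxemburg norm when `t ≤ φ t`. -/
lemma lintegral_le_volume_mul_luxNorm {n : ℕ} {φ : ℝ → ℝ} (hφ : ∀ t, 0 ≤ t → t ≤ φ t)
    {Q : Set (Fin n → ℝ)} (hQ0 : volume Q ≠ 0) (hQ : volume Q ≠ ∞) (f : (Fin n → ℝ) → ℝ) :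
    (∫⁻ x in Q, ENNReal.ofReal |f x|) / volume Q ≤ luxNorm φ Q f := by
  refine le_sInf ?_
  rintro _ ⟨c, hc, rfl, hle⟩
  rw [ENNReal.div_le_iff hQ0 hQ]
  calc ∫⁻ x in Q, ENNReal.ofReal |f x|
      ≤ ∫⁻ x in Q, ENNReal.ofReal c * ENNReal.ofReal (φ (|f x| / c)) := by
        refine lintegral_mono fun x => ?_
        rw [← ENNReal.ofReal_mul hc.le]
        refine ENNReal.ofReal_le_ofReal ?_
        have := hφ (|f x| / c) (by positivity)
        rwa [div_le_iff₀' hc] at this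
    _ = ENNReal.ofReal c * ∫⁻ x in Q, ENNReal.ofReal (φ (|f x| / c)) :=
        lintegral_const_mul' _ _ ENNReal.ofReal_ne_top
    _ ≤ _ := by gcongr

/-- The split for one admissible constant `s` in the Luxemburg norm of `σ`, with
`∫_Q f ^ r σ = j`. -/
lemma luxNorm_mul_le_of_lintegral_le {n m : ℕ} {r p K : ℝ} (h : r.HolderConjugate p) (hK : 1 ≤ K)
    (hmain : ∀ u w : ℝ, 0 ≤ u → 0 ≤ w →
      u ^ (1 / r) * w ^ (1 / p) * Real.log (Real.exp 1 + u ^ (1 / r) * w ^ (1 / p)) ^ m ≤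
        K * (u + w * Real.log (Real.exp 1 + w) ^ (m * p)))
    {Q : Set (Fin n → ℝ)} {v j s : ℝ} (hv : 0 < v) (hQ : volume Q = ENNReal.ofReal v)
    {σ f : (Fin n → ℝ) → ℝ} (hσm : Measurable σ) (hfm : Measurable f) (hσ : ∀ x, 0 ≤ σ x)
    (hf : ∀ x, 0 ≤ f x) (hj : 0 < j)
    (hJ : ∫⁻ x in Q, ENNReal.ofReal (f x) ^ r * ENNReal.ofReal (σ x) = ENNReal.ofReal j)
    (hs : 0 < s) (hle : ∫⁻ x in Q, ENNReal.ofReal (phiLog 1 (m * p) (|σ x| / s)) ≤ volume Q) :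
    luxNorm (fun t => t * Real.log (Real.exp 1 + t) ^ m) Q (fun x => f x * σ x) ≤
      ENNReal.ofReal (2 * K * s ^ (1 / p) * (j / v) ^ (1 / r)) := by
  have hr := h.lt
  have hp := h.symm.lt
  refine sInf_le ⟨_, by positivity, rfl, ?_⟩
  set B := j / v with hB
  have hB0 : 0 < B := by positivity
  have hpt : ∀ x, ENNReal.ofReal (|f x * σ x| / (2 * K * s ^ (1 / p) * B ^ (1 / r)) *
      Real.log (Real.exp 1 + |f x * σ x| / (2 * K * s ^ (1 / p) * B ^ (1 / r))) ^ m) ≤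
      ENNReal.ofReal 2⁻¹ * (ENNReal.ofReal B⁻¹ *
        (ENNReal.ofReal (f x) ^ r * ENNReal.ofReal (σ x)) +
        ENNReal.ofReal (phiLog 1 (m * p) (|σ x| / s))) := by
    intro x
    have hfx := hf x
    have hσx := hσ x
    have hphi : 0 ≤ phiLog 1 (m * p) (|σ x| / s) := by
      have := one_le_log_exp_one_add (by positivity : 0 ≤ |σ x| / s)
      unfold phiLog
      positivity
    rw [ENNReal.ofReal_rpow_of_nonneg hfx (by linarith), ← ENNReal.ofReal_mul (by positivity),
      ← ENNReal.ofReal_mul (by positivity), ← ENNReal.ofReal_add (by positivity) hphi,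
      ← ENNReal.ofReal_mul (by norm_num)]
    refine ENNReal.ofReal_le_ofReal ?_
    have key := hmain (B⁻¹ * (f x ^ r * σ x)) (σ x / s) (by positivity) (by positivity)
    set T := (B⁻¹ * (f x ^ r * σ x)) ^ (1 / r) * (σ x / s) ^ (1 / p) with hT
    have hT0 : 0 ≤ T := by positivity
    have hTeq : |f x * σ x| / (2 * K * s ^ (1 / p) * B ^ (1 / r)) = T / (2 * K) := by
      have e : σ x ^ (1 / r) * σ x ^ (1 / p) = σ x := by
        have h1 : 1 / r + 1 / p = 1 := by simpa using h.inv_add_inv_eq_one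
        rw [← Real.rpow_add_of_nonneg hσx (by positivity) (by positivity), h1, Real.rpow_one]
      rw [hT, Real.mul_rpow (by positivity) (by positivity),
        Real.mul_rpow (by positivity) (by positivity), Real.inv_rpow hB0.le,
        Real.div_rpow hσx hs.le, ← Real.rpow_mul hfx, mul_one_div_cancel (by linarith),
        Real.rpow_one, abs_of_nonneg (by positivity)]
      nth_rw 1 [← e]
      field_simp
    rw [hTeq, phiLog, Real.rpow_one, abs_of_nonneg hσx]
    have hTK : T / (2 * K) ≤ T := div_le_self hT0 (by linarith)
    have h1 := one_le_log_exp_one_add (by positivity : 0 ≤ T / (2 * K))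
    calc T / (2 * K) * Real.log (Real.exp 1 + T / (2 * K)) ^ m
        ≤ T / (2 * K) * Real.log (Real.exp 1 + T) ^ m := by
          gcongr
      _ = (T * Real.log (Real.exp 1 + T) ^ m) / (2 * K) := by ring
      _ ≤ K * (B⁻¹ * (f x ^ r * σ x) + σ x / s * Real.log (Real.exp 1 + σ x / s) ^ (m * p)) /
            (2 * K) := by gcongr
      _ = _ := by field_simp
  calc _ ≤ ∫⁻ x in Q, ENNReal.ofReal 2⁻¹ * (ENNReal.ofReal B⁻¹ *
        (ENNReal.ofReal (f x) ^ r * ENNReal.ofReal (σ x)) +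
        ENNReal.ofReal (phiLog 1 (m * p) (|σ x| / s))) := lintegral_mono hpt
    _ = ENNReal.ofReal 2⁻¹ * (ENNReal.ofReal B⁻¹ * ENNReal.ofReal j +
        ∫⁻ x in Q, ENNReal.ofReal (phiLog 1 (m * p) (|σ x| / s))) := by
      rw [lintegral_const_mul' _ _ ENNReal.ofReal_ne_top, lintegral_add_left (by fun_prop),
        lintegral_const_mul' _ _ ENNReal.ofReal_ne_top, hJ]
    _ ≤ ENNReal.ofReal 2⁻¹ * (ENNReal.ofReal v + ENNReal.ofReal v) := by
      rw [hQ] at hle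
      gcongr
      rw [← ENNReal.ofReal_mul (by positivity), hB]
      refine ENNReal.ofReal_le_ofReal (le_of_eq ?_)
      field_simp
    _ = volume Q := by
      rw [← ENNReal.ofReal_add hv.le hv.le, ← ENNReal.ofReal_mul (by norm_num), hQ]
      congr 1
      ring

/-- **Lemma: `‖fσ‖_{L(log L)^m,Q} ≲ ‖σ‖_{L(log L)^{mr'},Q}^{1/r'} (σ_Q)^{1/r} ‖f‖^σ_{L^r,Q}`.** -/
theorem orlicz_norm_weighted_split (n : ℕ) (m : ℕ) (hm : 1 ≤ m)
    (r : ℝ) (hr : 1 < r) :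
    ∃ C : ℝ, 0 < C ∧
      ∀ σ : (Fin n → ℝ) → ℝ, IsWeight σ →
        ∀ Q : Cube n, 0 < ∫ x in Q.set, σ x →
          ∀ f : (Fin n → ℝ) → ℝ, Measurable f → (∀ x, 0 ≤ f x) →
            luxNorm (fun t => t * Real.log (Real.exp 1 + t) ^ m) Q.set
                (fun x => f x * σ x) ≤
              ENNReal.ofReal C *
                luxNorm (phiLog 1 ((m : ℝ) * (r / (r - 1)))) Q.set σ ^
                  (1 / (r / (r - 1))) *
                ENNReal.ofReal (cubeAvg σ Q) ^ (1 / r) *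
                ((∫⁻ x in Q.set, ENNReal.ofReal (f x) ^ r * ENNReal.ofReal (σ x)) /
                    (∫⁻ x in Q.set, ENNReal.ofReal (σ x))) ^ (1 / r) := by
  set p := r / (r - 1) with hp_def
  have h : r.HolderConjugate p := Real.HolderConjugate.conjExponent hr
  have hp : 1 < p := h.symm.lt
  obtain ⟨K, hK, hmain⟩ := exists_rpow_mul_rpow_mul_log_pow_le hm h
  refine ⟨2 * K, by linarith, fun σ hσ Q hσQ f hfm hf => ?_⟩
  obtain ⟨hσm, hσ0, -⟩ := hσ
  have hvol := Q.volume_set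
  have hv : 0 < Q.side ^ n := pow_pos Q.side_pos n
  set v := Q.side ^ n with hv_def
  set a := ∫ x in Q.set, σ x with ha_def
  have h_integrable : Integrable σ (volume.restrict Q.set) := by
    by_contra hni
    rw [ha_def, integral_undef hni] at hσQ
    exact lt_irrefl _ hσQ
  have hI : ∫⁻ x in Q.set, ENNReal.ofReal (σ x) = ENNReal.ofReal a :=
    (ofReal_integral_eq_lintegral_ofReal h_integrable (Eventually.of_forall hσ0)).symm
  have hA : cubeAvg σ Q = a / v := by
    rw [cubeAvg, hvol, ENNReal.toReal_ofReal hv.le]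
  have hvol0 : volume Q.set ≠ 0 := by rw [hvol]; simpa using hv
  have hvolt : volume Q.set ≠ ∞ := by rw [hvol]; exact ENNReal.ofReal_ne_top
  have hlux : 0 < luxNorm (phiLog 1 (m * p)) Q.set σ := by
    refine lt_of_lt_of_le ?_ (lintegral_le_volume_mul_luxNorm (fun t ht => ?_) hvol0 hvolt σ)
    · simp_rw [abs_of_nonneg (hσ0 _)]
      rw [hI]
      exact ENNReal.div_pos (by simpa using hσQ) hvolt
    · rw [phiLog, Real.rpow_one]
      exact le_mul_of_one_le_right ht
        (Real.one_le_rpow (one_le_log_exp_one_add ht) (by positivity))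
  rw [hI, hA]
  set J := ∫⁻ x in Q.set, ENNReal.ofReal (f x) ^ r * ENNReal.ofReal (σ x) with hJ_def
  rcases eq_or_ne J 0 with hJ0 | hJ0
  · rw [luxNorm_eq_zero_of_ae (by simp)]
    · exact zero_le
    · rw [hJ_def, lintegral_eq_zero_iff (by fun_prop)] at hJ0
      filter_upwards [hJ0] with x hx
      simp only [Pi.zero_apply, mul_eq_zero, ENNReal.rpow_eq_zero_iff] at hx
      rcases hx with (hx | hx) | hx
      · rw [le_antisymm (ENNReal.ofReal_eq_zero.1 hx.1) (hf x), zero_mul]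
      · exact absurd hx.1 ENNReal.ofReal_ne_top
      · rw [le_antisymm (ENNReal.ofReal_eq_zero.1 hx) (hσ0 x), mul_zero]
  rcases eq_or_ne J ∞ with hJt | hJt
  · have hr0 : 0 < 1 / r := by positivity
    rw [hJt, ENNReal.top_div_of_ne_top ENNReal.ofReal_ne_top, ENNReal.top_rpow_of_pos hr0,
      ENNReal.mul_top]
    · exact le_top
    · refine mul_ne_zero (mul_ne_zero ?_ ?_) ?_
      · simp; linarith
      · exact (ENNReal.rpow_pos_of_nonneg hlux (by positivity)).ne'
      · rw [ENNReal.ofReal_rpow_of_pos (by positivity)]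
        simp only [ne_eq, ENNReal.ofReal_eq_zero, not_le]
        positivity
  set j := J.toReal with hj_def
  have hj : 0 < j := ENNReal.toReal_pos hJ0 hJt
  have hJj : J = ENNReal.ofReal j := (ENNReal.ofReal_toReal hJt).symm
  have hD : ENNReal.ofReal (a / v) ^ (1 / r) * (J / ENNReal.ofReal a) ^ (1 / r) =
      ENNReal.ofReal ((j / v) ^ (1 / r)) := by
    rw [hJj, ← ENNReal.ofReal_div_of_pos hσQ, ← ENNReal.mul_rpow_of_nonneg _ _ (by positivity),
      ← ENNReal.ofReal_mul (by positivity), ENNReal.ofReal_rpow_of_nonneg (by positivity)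
        (by positivity)]
    congr 2
    field_simp
  set D := (j / v) ^ (1 / r) with hD_def
  have hD0 : 0 < D := by positivity
  set E := ENNReal.ofReal (2 * K * D) with hE
  have hE0 : E ≠ 0 := by
    simp only [hE, ne_eq, ENNReal.ofReal_eq_zero, not_le]
    positivity
  have hEt : E ≠ ∞ := ENNReal.ofReal_ne_top
  rw [mul_assoc, hD, mul_right_comm, ← ENNReal.ofReal_mul (by positivity), ← hE, mul_comm,
    ← ENNReal.div_le_iff hE0 hEt, one_div, ENNReal.le_rpow_inv_iff (by linarith)]
  refine le_sInf ?_
  rintro _ ⟨s, hs, rfl, hle⟩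
  rw [← ENNReal.le_rpow_inv_iff (by linarith), ← one_div, ENNReal.div_le_iff hE0 hEt]
  refine (luxNorm_mul_le_of_lintegral_le h hK hmain hv hvol hσm hfm hσ0 hf hj hJj hs hle).trans
    (le_of_eq ?_)
  rw [ENNReal.ofReal_rpow_of_pos hs, hE, ← ENNReal.ofReal_mul (by positivity)]
  congr 1
  ring

end
end

section
/- Let p > 1 and p' = p/(p−1). There exist weights u and v on ℝ such that: (i) sup over all bounded intervals I of ‖u^{1/p}‖_{L^p(log L)^{p−1/2},I}·‖v^{−1/p}‖_{L^{p'}(log L)^{2p'−1/2},I} < ∞; (ii) sup over all bounded intervals I of ‖u^{1/p}‖_{L^p(log L)^{2p−1/2},I}·‖v^{−1/p}‖_{L^{p'}(log L)^{p'−1/2},I} < ∞; and yet (iii) sup over all bounded intervals I of ‖u^{1/p}‖_{L^p(log L)^{2p−1},I}·‖v^{−1/p}‖_{L^{p'}(log L)^{2p'−1},I} = ∞. -/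
open MeasureTheory ENNReal Filter

noncomputable section

/-- A weight on `ℝ`: a non-negative, locally integrable function. -/
def IsWeight1 (w : ℝ → ℝ) : Prop :=
  Measurable w ∧ (∀ x, 0 ≤ w x) ∧ LocallyIntegrable w volume

/-- The normalized Luxemburg norm over a set `J ⊆ ℝ` (with value `∞` if no λ works). -/
def luxNorm1 (φ : ℝ → ℝ) (J : Set ℝ) (f : ℝ → ℝ) : ℝ≥0∞ :=
  sInf {l : ℝ≥0∞ | ∃ c : ℝ, 0 < c ∧ l = ENNReal.ofReal c ∧
    (∫⁻ x in J, ENNReal.ofReal (φ (|f x| / c))) ≤ volume J}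

/-- The separated-bump constant: supremum over all bounded intervals of the product of
two Luxemburg norms. -/
def bumpI (A B : ℝ → ℝ) (g h : ℝ → ℝ) : ℝ≥0∞ :=
  ⨆ (a : ℝ) (b : ℝ) (_ : a < b),
    luxNorm1 A (Set.Ioc a b) g * luxNorm1 B (Set.Ioc a b) h

lemma phiLog_nonneg {q a t : ℝ} (ht : 0 ≤ t) : 0 ≤ phiLog q a t := by
  have h : 0 ≤ Real.log (Real.exp 1 + t) :=
    Real.log_nonneg (by linarith [Real.add_one_le_exp (1 : ℝ)])
  unfold phiLog
  positivity

lemma phiLog_mono {q a s t : ℝ} (hq : 0 ≤ q) (ha : 0 ≤ a) (hs : 0 ≤ s) (hst : s ≤ t) :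
    phiLog q a s ≤ phiLog q a t := by
  have he := Real.add_one_le_exp (1 : ℝ)
  have h : 0 ≤ Real.log (Real.exp 1 + s) := Real.log_nonneg (by linarith)
  have h' : Real.log (Real.exp 1 + s) ≤ Real.log (Real.exp 1 + t) :=
    Real.log_le_log (by linarith) (by linarith)
  have ht : 0 ≤ t := hs.trans hst
  unfold phiLog
  gcongr

lemma phiLog_zero {q a : ℝ} (hq : q ≠ 0) : phiLog q a 0 = 0 := by
  simp [phiLog, Real.zero_rpow hq]

lemma phiLog_le {q a t : ℝ} (k : ℕ) (ha : 0 ≤ a) (ht : 0 ≤ t) (htk : t ≤ 16 ^ k) :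
    phiLog q a t ≤ t ^ q * (3 * ((k : ℝ) + 1)) ^ a := by
  have he := Real.add_one_le_exp (1 : ℝ)
  have he' := Real.exp_one_lt_d9
  have h : 0 ≤ Real.log (Real.exp 1 + t) := Real.log_nonneg (by linarith)
  have h1 : (1 : ℝ) ≤ 16 ^ k := one_le_pow₀ (by norm_num)
  have h2 : Real.log (Real.exp 1 + t) ≤ 3 * ((k : ℝ) + 1) := by
    calc Real.log (Real.exp 1 + t) ≤ Real.log ((2 : ℝ) ^ (4 * (k + 1))) := by
          apply Real.log_le_log (by linarith)
          rw [pow_mul, pow_succ]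
          norm_num
          linarith
      _ = 4 * ((k : ℝ) + 1) * Real.log 2 := by
          rw [Real.log_pow]; push_cast; ring
      _ ≤ 3 * ((k : ℝ) + 1) := by
          have := Real.log_two_lt_d9
          have : (0 : ℝ) ≤ k := k.cast_nonneg
          nlinarith
  unfold phiLog
  gcongr

/-- Powers are dominated by exponentials. -/
lemma exists_rpow_le_pow (a : ℝ) : ∃ M : ℝ, 0 < M ∧ ∀ k : ℕ, ((k : ℝ) + 1) ^ a ≤ M * 16 ^ k := by
  obtain ⟨N, hN⟩ := exists_nat_ge a
  refine ⟨N.factorial * Real.exp 1, by positivity, fun k => ?_⟩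
  have hk : (0 : ℝ) ≤ k := k.cast_nonneg
  have h1 : ((k : ℝ) + 1) ^ a ≤ ((k : ℝ) + 1) ^ N := by
    rw [← Real.rpow_natCast]
    exact Real.rpow_le_rpow_of_exponent_le (by linarith) hN
  have h2 := Real.pow_div_factorial_le_exp ((k : ℝ) + 1) (by positivity) N
  have h3 : Real.exp k ≤ 16 ^ k := by
    rw [← Real.exp_one_pow]
    have := Real.exp_one_lt_d9
    gcongr
    linarith
  rw [div_le_iff₀ (by positivity), Real.exp_add] at h2
  calc ((k : ℝ) + 1) ^ a ≤ Real.exp k * Real.exp 1 * N.factorial := h1.trans h2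
    _ ≤ 16 ^ k * Real.exp 1 * N.factorial := by gcongr
    _ = N.factorial * Real.exp 1 * 16 ^ k := by ring

/-- The height `16 ^ j / (j + 1) ^ (5 / 2)` of the spike at `16 ^ j`. -/
def spikeHeight (j : ℕ) : ℝ := 16 ^ j / ((j : ℝ) + 1) ^ (5 / 2 : ℝ)

lemma spikeHeight_pos (j : ℕ) : 0 < spikeHeight j := by unfold spikeHeight; positivity

lemma spikeHeight_le (j : ℕ) : spikeHeight j ≤ 16 ^ j := by
  have hj : (0 : ℝ) ≤ j := j.cast_nonneg
  exact div_le_self (by positivity) (Real.one_le_rpow (by linarith) (by norm_num))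

lemma one_le_spikeHeight (j : ℕ) : 1 ≤ spikeHeight j := by
  have hj : (0 : ℝ) ≤ j := j.cast_nonneg
  have h : (j : ℝ) + 1 ≤ 2 ^ j := by exact_mod_cast Nat.lt_two_pow_self
  unfold spikeHeight
  rw [one_le_div (by positivity)]
  calc ((j : ℝ) + 1) ^ (5 / 2 : ℝ) ≤ ((j : ℝ) + 1) ^ (4 : ℝ) :=
        Real.rpow_le_rpow_of_exponent_le (by linarith) (by norm_num)
    _ = ((j : ℝ) + 1) ^ 4 := by
        rw [← Real.rpow_natCast]
        norm_num
    _ ≤ (2 ^ j) ^ 4 := by gcongr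
    _ = 16 ^ j := by rw [← pow_mul, mul_comm, pow_mul]; norm_num

lemma two_mul_spikeHeight_le (j : ℕ) : 2 * spikeHeight j ≤ spikeHeight (j + 1) := by
  have hj : (0 : ℝ) ≤ j := j.cast_nonneg
  have h : (((j + 1 : ℕ) : ℝ) + 1) ^ (5 / 2 : ℝ) ≤ 8 * ((j : ℝ) + 1) ^ (5 / 2 : ℝ) := by
    calc (((j + 1 : ℕ) : ℝ) + 1) ^ (5 / 2 : ℝ) ≤ (2 * ((j : ℝ) + 1)) ^ (5 / 2 : ℝ) := by
          gcongr; push_cast; linarith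
      _ = 2 ^ (5 / 2 : ℝ) * ((j : ℝ) + 1) ^ (5 / 2 : ℝ) :=
          Real.mul_rpow (by norm_num) (by positivity)
      _ ≤ 2 ^ (3 : ℝ) * ((j : ℝ) + 1) ^ (5 / 2 : ℝ) := by
          gcongr <;> norm_num
      _ = _ := by norm_num
  unfold spikeHeight
  rw [le_div_iff₀ (by positivity), mul_div_assoc', div_mul_eq_mul_div, div_le_iff₀ (by positivity),
    pow_succ]
  nlinarith [pow_pos (show (0 : ℝ) < 16 by norm_num) j]

lemma monotone_spikeHeight : Monotone spikeHeight :=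
  monotone_nat_of_le_succ fun j => by
    linarith [two_mul_spikeHeight_le j, spikeHeight_pos j]

lemma sum_spikeHeight_rpow_le {q : ℝ} (hq : 1 ≤ q) (k : ℕ) :
    ∑ j ∈ Finset.range k, spikeHeight (j + 1) ^ q ≤ 2 * spikeHeight k ^ q := by
  induction k with
  | zero => simpa using Real.rpow_nonneg (spikeHeight_pos 0).le q
  | succ k ih =>
    have h : 2 * spikeHeight k ^ q ≤ spikeHeight (k + 1) ^ q := by
      have h0 := spikeHeight_pos k
      calc 2 * spikeHeight k ^ q ≤ 2 ^ q * spikeHeight k ^ q := by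
            gcongr
            simpa using Real.rpow_le_rpow_of_exponent_le (x := 2) (by norm_num) hq
        _ = (2 * spikeHeight k) ^ q := (Real.mul_rpow (by norm_num) h0.le).symm
        _ ≤ _ := by
            gcongr
            exact two_mul_spikeHeight_le k
    rw [Finset.sum_range_succ]
    linarith

/-- The sequence equal to `spikeHeight j` at `16 ^ j` and to `1` elsewhere. -/
def spikeSeq (n : ℕ) : ℝ := if n = 16 ^ Nat.log 16 n then spikeHeight (Nat.log 16 n) else 1

lemma one_le_spikeSeq (n : ℕ) : 1 ≤ spikeSeq n := by
  unfold spikeSeq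
  split_ifs
  · exact one_le_spikeHeight _
  · exact le_rfl

lemma spikeSeq_pow (j : ℕ) : spikeSeq (16 ^ j) = spikeHeight j := by
  simp [spikeSeq, Nat.log_pow]

lemma spikeSeq_eq_one_or {n k : ℕ} (hn : n < 16 ^ (k + 1)) :
    spikeSeq n = 1 ∨ ∃ j < k, n = 16 ^ (j + 1) ∧ spikeSeq n = spikeHeight (j + 1) := by
  by_cases h : n = 16 ^ Nat.log 16 n
  · rcases hm : Nat.log 16 n with _ | j
    · left
      rw [hm] at h
      simp [h, spikeSeq, spikeHeight]
    · right
      rw [hm] at h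
      refine ⟨j, ?_, h, by rw [h, spikeSeq_pow]⟩
      rw [h] at hn
      have := (Nat.pow_lt_pow_iff_right (by norm_num : 1 < 16)).1 hn
      omega
  · left
    rw [spikeSeq, if_neg h]

lemma lintegral_spikeSeq_le (F : ℝ → ℝ≥0∞) {a b : ℝ} {k : ℕ} (hb : b < 16 ^ (k + 1)) :
    ∫⁻ x in Set.Ioc a b, F (spikeSeq ⌊x⌋₊) ≤
      F 1 * volume (Set.Ioc a b) + ∑ j ∈ Finset.range k, F (spikeHeight (j + 1)) := by
  have hm : ∀ j ∈ Finset.range k, Measurable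
      ((Set.Ico ((16 : ℝ) ^ (j + 1)) (16 ^ (j + 1) + 1)).indicator
        fun _ => F (spikeHeight (j + 1))) :=
    fun j _ => measurable_const.indicator measurableSet_Ico
  calc ∫⁻ x in Set.Ioc a b, F (spikeSeq ⌊x⌋₊)
      ≤ ∫⁻ x in Set.Ioc a b, (F 1 + ∑ j ∈ Finset.range k,
          (Set.Ico ((16 : ℝ) ^ (j + 1)) (16 ^ (j + 1) + 1)).indicator
            (fun _ => F (spikeHeight (j + 1))) x) := by
        apply setLIntegral_mono' measurableSet_Ioc
        intro x hx
        have hn : ⌊x⌋₊ < 16 ^ (k + 1) := by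
          rw [Nat.floor_lt' (by positivity)]
          push_cast
          exact hx.2.trans_lt hb
        rcases spikeSeq_eq_one_or hn with h | ⟨j, hj, hnj, h⟩
        · rw [h]; exact le_self_add
        · rw [h]
          have hx' : x ∈ Set.Ico ((16 : ℝ) ^ (j + 1)) (16 ^ (j + 1) + 1) := by
            have := (Nat.floor_eq_iff' (a := x) (n := 16 ^ (j + 1)) (by positivity)).1 hnj
            push_cast at this
            exact this
          refine le_trans ?_ le_add_self
          refine le_trans ?_ (Finset.single_le_sum (fun _ _ => zero_le)
            (Finset.mem_range.2 hj))
          rw [Set.indicator_of_mem hx']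
    _ = F 1 * volume (Set.Ioc a b) + ∑ j ∈ Finset.range k,
          ∫⁻ x in Set.Ioc a b, (Set.Ico ((16 : ℝ) ^ (j + 1)) (16 ^ (j + 1) + 1)).indicator
            (fun _ => F (spikeHeight (j + 1))) x := by
        rw [lintegral_add_left measurable_const, setLIntegral_const,
          lintegral_finsetSum _ hm]
    _ ≤ _ := by
        gcongr with j _
        refine (setLIntegral_le_lintegral _ _).trans ?_
        rw [lintegral_indicator measurableSet_Ico, setLIntegral_const]
        simp

lemma luxNorm1_le {φ f : ℝ → ℝ} {J : Set ℝ} {c : ℝ} (hc : 0 < c)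
    (h : ∫⁻ x in J, ENNReal.ofReal (φ (|f x| / c)) ≤ volume J) :
    luxNorm1 φ J f ≤ ENNReal.ofReal c :=
  sInf_le ⟨c, hc, rfl, h⟩

lemma le_luxNorm1 {φ f : ℝ → ℝ} {J S : Set ℝ} {y c₀ : ℝ} (hS : MeasurableSet S)
    (hSJ : S ⊆ J) (hS1 : volume S = 1) (hf : ∀ x ∈ S, f x = y)
    (h : ∀ c, 0 < c → ENNReal.ofReal (φ (|y| / c)) ≤ volume J → c₀ ≤ c) :
    ENNReal.ofReal c₀ ≤ luxNorm1 φ J f := by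
  apply le_sInf
  rintro l ⟨c, hc, rfl, hl⟩
  apply ENNReal.ofReal_le_ofReal
  apply h c hc
  calc ENNReal.ofReal (φ (|y| / c)) = ∫⁻ _ in S, ENNReal.ofReal (φ (|y| / c)) := by
        rw [setLIntegral_const, hS1, mul_one]
    _ = ∫⁻ x in S, ENNReal.ofReal (φ (|f x| / c)) :=
        setLIntegral_congr_fun hS fun x hx => by simp only [hf x hx]
    _ ≤ ∫⁻ x in J, ENNReal.ofReal (φ (|f x| / c)) := lintegral_mono_set hSJ
    _ ≤ volume J := hl

lemma luxNorm1_eq_zero {φ f : ℝ → ℝ} {J : Set ℝ} (hJ : MeasurableSet J) (hφ : φ 0 = 0)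
    (hf : ∀ x ∈ J, f x = 0) : luxNorm1 φ J f = 0 := by
  have h : ∀ c : ℝ, 0 < c → luxNorm1 φ J f ≤ ENNReal.ofReal c := fun c hc => by
    apply luxNorm1_le hc
    rw [setLIntegral_congr_fun (g := fun _ => 0) hJ fun x hx => by simp [hf x hx, hφ]]
    simp
  refine le_antisymm (ENNReal.le_of_forall_pos_le_add fun ε hε _ => ?_) zero_le
  simpa using h ε hε

lemma lintegral_indicator_le {φ : ℝ → ℝ} {a b c : ℝ} (hφ : φ 0 = 0)
    (h : φ (1 / c) ≤ max 1 (b - a)) :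
    ∫⁻ x in Set.Ioc a b,
        ENNReal.ofReal (φ (|(Set.Ico (0 : ℝ) 1).indicator (fun _ => (1 : ℝ)) x| / c)) ≤
      volume (Set.Ioc a b) := by
  have e : ∀ x, ENNReal.ofReal (φ (|(Set.Ico (0 : ℝ) 1).indicator (fun _ => (1 : ℝ)) x| / c)) =
      (Set.Ico (0 : ℝ) 1).indicator (fun _ => ENNReal.ofReal (φ (1 / c))) x := fun x => by
    by_cases hx : x ∈ Set.Ico (0 : ℝ) 1
    · rw [Set.indicator_of_mem hx, Set.indicator_of_mem hx, abs_one]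
    · rw [Set.indicator_of_notMem hx, Set.indicator_of_notMem hx]
      simp [hφ]
  simp_rw [e]
  rw [lintegral_indicator measurableSet_Ico, setLIntegral_const,
    Measure.restrict_apply measurableSet_Ico]
  rcases le_total 1 (b - a) with hR | hR
  · rw [max_eq_right hR] at h
    calc ENNReal.ofReal (φ (1 / c)) * volume (Set.Ico 0 1 ∩ Set.Ioc a b)
        ≤ ENNReal.ofReal (b - a) * volume (Set.Ico (0 : ℝ) 1) := by
          gcongr; exact Set.inter_subset_left
      _ = volume (Set.Ioc a b) := by simp
  · rw [max_eq_left hR] at h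
    calc ENNReal.ofReal (φ (1 / c)) * volume (Set.Ico 0 1 ∩ Set.Ioc a b)
        ≤ ENNReal.ofReal 1 * volume (Set.Ioc a b) := by
          gcongr; exact Set.inter_subset_right
      _ = volume (Set.Ioc a b) := by simp

/-- The comparison scale `16 ^ (k / r) (k + 1) ^ (-a / r)`. -/
def logScale (r a : ℝ) (k : ℕ) : ℝ := ((16 : ℝ) ^ k) ^ (1 / r) * ((k : ℝ) + 1) ^ (-(a / r))

lemma logScale_pos (r a : ℝ) (k : ℕ) : 0 < logScale r a k := by unfold logScale; positivity

lemma logScale_rpow {r : ℝ} (a s : ℝ) (k : ℕ) :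
    logScale r a k ^ s = ((16 : ℝ) ^ k) ^ (s / r) * ((k : ℝ) + 1) ^ (-(a * s / r)) := by
  unfold logScale
  rw [Real.mul_rpow (by positivity) (by positivity), ← Real.rpow_mul (by positivity),
    ← Real.rpow_mul (by positivity)]
  ring_nf

lemma logScale_le {r a : ℝ} (hr : 1 ≤ r) (ha : 0 ≤ a) (k : ℕ) : logScale r a k ≤ 16 ^ k := by
  have h1 : (1 : ℝ) ≤ 16 ^ k := one_le_pow₀ (by norm_num)
  have hk : (0 : ℝ) ≤ k := k.cast_nonneg
  have h2 : ((16 : ℝ) ^ k) ^ (1 / r) ≤ (16 : ℝ) ^ k := by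
    simpa using Real.rpow_le_rpow_of_exponent_le h1 ((div_le_one (by linarith)).2 hr)
  have h3 : ((k : ℝ) + 1) ^ (-(a / r)) ≤ 1 :=
    Real.rpow_le_one_of_one_le_of_nonpos (by linarith) (by simp only [neg_nonpos]; positivity)
  calc logScale r a k ≤ 16 ^ k * 1 := by unfold logScale; gcongr
    _ = _ := mul_one _

/-- `logScale r a k` is bounded below by a multiple of `16 ^ (k / (2 r))`. -/
lemma exists_rpow_le_mul_logScale {r : ℝ} (hr : 1 ≤ r) (a : ℝ) :
    ∃ M : ℝ, 0 < M ∧ ∀ k : ℕ, ((16 : ℝ) ^ k) ^ (1 / (2 * r)) ≤ M * logScale r a k := by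
  obtain ⟨M, hM, h⟩ := exists_rpow_le_pow (2 * a)
  refine ⟨M ^ (1 / (2 * r)), by positivity, fun k => ?_⟩
  have h1 : ((k : ℝ) + 1) ^ (a / r) ≤ M ^ (1 / (2 * r)) * ((16 : ℝ) ^ k) ^ (1 / (2 * r)) := by
    calc ((k : ℝ) + 1) ^ (a / r) = (((k : ℝ) + 1) ^ (2 * a)) ^ (1 / (2 * r)) := by
          rw [← Real.rpow_mul (by positivity)]
          congr 1
          field_simp
      _ ≤ (M * 16 ^ k) ^ (1 / (2 * r)) := by
          gcongr
          exact h k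
      _ = _ := Real.mul_rpow hM.le (by positivity)
  unfold logScale
  rw [Real.rpow_neg (by positivity), ← mul_assoc, ← div_eq_mul_inv, le_div_iff₀ (by positivity)]
  have e : ((16 : ℝ) ^ k) ^ (1 / r) =
      ((16 : ℝ) ^ k) ^ (1 / (2 * r)) * ((16 : ℝ) ^ k) ^ (1 / (2 * r)) := by
    rw [← Real.rpow_add (by positivity)]
    congr 1
    field_simp
    norm_num
  rw [e]
  calc _ ≤ ((16 : ℝ) ^ k) ^ (1 / (2 * r)) *
        (M ^ (1 / (2 * r)) * ((16 : ℝ) ^ k) ^ (1 / (2 * r))) := by gcongr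
    _ = _ := by ring

lemma exists_phiLog_mul_logScale_le {r a : ℝ} (hr : 1 ≤ r) (ha : 0 ≤ a) :
    ∃ κ : ℝ, 0 < κ ∧ ∀ k : ℕ, phiLog r a (κ * logScale r a k) ≤ 16 ^ k / 2 := by
  have hr0 : 0 < r := by linarith
  have h3 : (1 : ℝ) ≤ 3 ^ a := Real.one_le_rpow (by norm_num) ha
  set κ : ℝ := (1 / (2 * 3 ^ a)) ^ (1 / r) with hκ
  have hκ0 : 0 < κ := by positivity
  have hκ1 : κ ≤ 1 := by
    apply Real.rpow_le_one (by positivity) _ (by positivity)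
    rw [div_le_one (by positivity)]
    linarith
  refine ⟨κ, hκ0, fun k => ?_⟩
  have hs := logScale_pos r a k
  have hκr : κ ^ r = 1 / (2 * 3 ^ a) := by
    rw [hκ, ← Real.rpow_mul (by positivity), one_div_mul_cancel hr0.ne', Real.rpow_one]
  refine (phiLog_le k ha (by positivity) ?_).trans_eq ?_
  · exact (mul_le_of_le_one_left hs.le hκ1).trans (logScale_le hr ha k)
  · rw [Real.mul_rpow hκ0.le hs.le, hκr, logScale_rpow, div_self hr0.ne', Real.rpow_one,
      mul_div_cancel_right₀ _ hr0.ne', Real.mul_rpow (by norm_num) (by positivity),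
      Real.rpow_neg (by positivity)]
    field_simp

lemma exists_phiLog_spikeHeight_le {p q a b : ℝ} (hpq : p.HolderConjugate q) (hb : 0 ≤ b)
    (hab : a / p + b / q = 5 / 2) :
    ∃ D : ℝ, 0 < D ∧ ∀ k : ℕ, phiLog q b (1 / (D * logScale p a k)) ≤ 1 / 2 ∧
      ∑ j ∈ Finset.range k, phiLog q b (spikeHeight (j + 1) / (D * logScale p a k)) ≤
        16 ^ k / 4 := by
  have hp1 := hpq.lt
  have hq1 := hpq.symm.lt
  have hp0 : 0 < p := by linarith
  have hq0 : 0 < q := by linarith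
  obtain ⟨M, hM, hMk⟩ := exists_rpow_le_mul_logScale hp1.le a
  have ev : Tendsto (fun D : ℝ => D ^ (-q)) atTop (nhds 0) := tendsto_rpow_neg_atTop hq0
  have ev1 : ∀ᶠ D : ℝ in atTop, D ^ (-q) ≤ 1 / (M ^ q * 3 ^ b * 2) :=
    ev.eventually_le_const (by positivity)
  have ev2 : ∀ᶠ D : ℝ in atTop, D ^ (-q) ≤ 1 / (3 ^ b * 8) :=
    ev.eventually_le_const (by positivity)
  obtain ⟨D, h1, h2, hDM, hD⟩ :=
    (ev1.and (ev2.and ((eventually_ge_atTop M).and (eventually_gt_atTop 0)))).exists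
  refine ⟨D, hD, fun k => ?_⟩
  have hs := logScale_pos p a k
  have hT : (1 : ℝ) ≤ 16 ^ k := one_le_pow₀ (by norm_num)
  have hsM : 1 ≤ M * logScale p a k :=
    (Real.one_le_rpow hT (by positivity)).trans (hMk k)
  have hd1 : 1 ≤ D * logScale p a k := hsM.trans (by gcongr)
  have hd0 : 0 < D * logScale p a k := by linarith
  have hDq : D ^ (-q) = 1 / D ^ q := by rw [Real.rpow_neg hD.le, one_div]
  constructor
  · have hle : 1 / (D * logScale p a k) ≤ M / D := by
      rw [div_le_div_iff₀ hd0 hD]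
      nlinarith
    calc phiLog q b (1 / (D * logScale p a k))
        ≤ (1 / (D * logScale p a k)) ^ q * (3 * (((0 : ℕ) : ℝ) + 1)) ^ b :=
          phiLog_le 0 hb (by positivity) (by simpa using inv_le_one_of_one_le₀ hd1)
      _ ≤ (M / D) ^ q * 3 ^ b := by
          norm_num only [Nat.cast_zero, zero_add, mul_one]
          gcongr
      _ = M ^ q * 3 ^ b * D ^ (-q) := by
          rw [Real.div_rpow hM.le hD.le, hDq]; ring
      _ ≤ M ^ q * 3 ^ b * (1 / (M ^ q * 3 ^ b * 2)) := by gcongr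
      _ = 1 / 2 := by field_simp
  · have hterm : ∀ j ∈ Finset.range k,
        phiLog q b (spikeHeight (j + 1) / (D * logScale p a k)) ≤
          spikeHeight (j + 1) ^ q *
            ((3 * ((k : ℝ) + 1)) ^ b / (D * logScale p a k) ^ q) := by
      intro j hj
      have hj' : j + 1 ≤ k := Finset.mem_range.1 hj
      have hL := spikeHeight_pos (j + 1)
      refine (phiLog_le k hb (by positivity) ?_).trans_eq ?_
      · exact (div_le_self hL.le hd1).trans
          ((monotone_spikeHeight hj').trans (spikeHeight_le k))
      · rw [Real.div_rpow hL.le hd0.le]; ring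
    have hℓ : (0 : ℝ) < (k : ℝ) + 1 := by positivity
    have hconj := hpq.inv_add_inv_eq_one
    have e1 : q - q / p = 1 := by
      have : q * (p⁻¹ + q⁻¹) = q := by rw [hconj, mul_one]
      rw [mul_add, mul_inv_cancel₀ hq0.ne'] at this
      rw [div_eq_mul_inv]; linarith
    have e2 : -(5 / 2 * q) + a * q / p + b = 0 := by
      rw [← hab]; field_simp; ring
    calc _ ≤ ∑ j ∈ Finset.range k, spikeHeight (j + 1) ^ q *
            ((3 * ((k : ℝ) + 1)) ^ b / (D * logScale p a k) ^ q) := Finset.sum_le_sum hterm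
      _ ≤ 2 * spikeHeight k ^ q *
            ((3 * ((k : ℝ) + 1)) ^ b / (D * logScale p a k) ^ q) := by
          rw [← Finset.sum_mul]
          gcongr
          exact sum_spikeHeight_rpow_le hq1.le k
      _ = 2 * 3 ^ b * D ^ (-q) * (((16 : ℝ) ^ k) ^ (q - q / p) *
            ((k : ℝ) + 1) ^ (-(5 / 2 * q) + a * q / p + b)) := by
          rw [Real.mul_rpow hD.le hs.le, logScale_rpow, spikeHeight,
            Real.div_rpow (by positivity) (by positivity),
            Real.mul_rpow (by norm_num) hℓ.le, ← Real.rpow_mul hℓ.le,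
            Real.rpow_sub (by positivity), Real.rpow_add hℓ, Real.rpow_add hℓ,
            Real.rpow_neg hℓ.le, Real.rpow_neg hℓ.le, Real.rpow_neg hD.le]
          field_simp
      _ = 2 * 3 ^ b * D ^ (-q) * 16 ^ k := by
          rw [e1, e2, Real.rpow_one, Real.rpow_zero, mul_one]
      _ ≤ 2 * 3 ^ b * (1 / (3 ^ b * 8)) * 16 ^ k := by gcongr
      _ = 16 ^ k / 4 := by field_simp; norm_num

theorem bumpI_spike_lt_top {p q a b : ℝ} (hpq : p.HolderConjugate q) (ha : 0 ≤ a) (hb : 0 ≤ b)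
    (hab : a / p + b / q = 5 / 2) :
    bumpI (phiLog p a) (phiLog q b) ((Set.Ico (0 : ℝ) 1).indicator fun _ => 1)
      (fun x => spikeSeq ⌊x⌋₊) < ⊤ := by
  have hp1 := hpq.lt
  have hq1 := hpq.symm.lt
  obtain ⟨κ, hκ, hA⟩ := exists_phiLog_mul_logScale_le hp1.le ha
  obtain ⟨D, hD, hB⟩ := exists_phiLog_spikeHeight_le hpq hb hab
  refine lt_of_le_of_lt ?_ (ENNReal.ofReal_lt_top (r := 1 / κ * D))
  refine iSup_le fun x => iSup_le fun y => iSup_le fun hxy => ?_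
  by_cases hmeet : x < 1 ∧ 0 ≤ y
  swap
  · rw [luxNorm1_eq_zero measurableSet_Ioc (phiLog_zero (by linarith)), zero_mul]
    · exact zero_le
    intro z hz
    apply Set.indicator_of_notMem
    intro hz'
    exact hmeet ⟨hz.1.trans hz'.2, hz'.1.trans hz.2⟩
  obtain ⟨k, hk1, hk2⟩ := exists_nat_pow_near (x := 2 * max 1 (y - x)) (y := 16)
    (by linarith [le_max_left 1 (y - x)]) (by norm_num)
  have hs := logScale_pos p a k
  have hφA : luxNorm1 (phiLog p a) (Set.Ioc x y) ((Set.Ico (0 : ℝ) 1).indicator fun _ => 1) ≤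
      ENNReal.ofReal (1 / (κ * logScale p a k)) := by
    apply luxNorm1_le (by positivity)
    apply lintegral_indicator_le (phiLog_zero (by linarith))
    rw [one_div_one_div]
    linarith [hA k]
  have hφB : luxNorm1 (phiLog q b) (Set.Ioc x y) (fun x => spikeSeq ⌊x⌋₊) ≤
      ENNReal.ofReal (D * logScale p a k) := by
    have hd : 0 < D * logScale p a k := by positivity
    apply luxNorm1_le hd
    have hy : y < 16 ^ (k + 1) := by
      refine lt_of_le_of_lt ?_ hk2
      linarith [le_max_left 1 (y - x), le_max_right 1 (y - x)]
    refine (lintegral_spikeSeq_le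
      (fun t => ENNReal.ofReal (phiLog q b (|t| / (D * logScale p a k)))) hy).trans ?_
    have hsum : ∑ j ∈ Finset.range k,
        phiLog q b (spikeHeight (j + 1) / (D * logScale p a k)) ≤ (y - x) / 2 := by
      rcases Nat.eq_zero_or_pos k with rfl | hkpos
      · simp; linarith
      · refine (hB k).2.trans ?_
        have h16 : (16 : ℝ) ≤ 16 ^ k := le_self_pow₀ (by norm_num) hkpos.ne'
        rcases le_total 1 (y - x) with h | h
        · rw [max_eq_right h] at hk1; linarith
        · rw [max_eq_left h] at hk1; linarith
    have hnn : ∀ j, 0 ≤ phiLog q b (spikeHeight (j + 1) / (D * logScale p a k)) := fun j =>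
      phiLog_nonneg (div_nonneg (spikeHeight_pos _).le hd.le)
    simp only [abs_one, abs_of_pos (spikeHeight_pos _)]
    rw [Real.volume_Ioc, ← ENNReal.ofReal_sum_of_nonneg fun j _ => hnn j,
      ← ENNReal.ofReal_mul (phiLog_nonneg (by positivity)),
      ← ENNReal.ofReal_add (mul_nonneg (phiLog_nonneg (by positivity)) (by linarith))
        (Finset.sum_nonneg fun j _ => hnn j)]
    apply ENNReal.ofReal_le_ofReal
    have := mul_le_mul_of_nonneg_right (hB k).1 (sub_nonneg.2 hxy.le)
    linarith
  calc _ ≤ ENNReal.ofReal (1 / (κ * logScale p a k)) * ENNReal.ofReal (D * logScale p a k) :=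
        mul_le_mul' hφA hφB
    _ = ENNReal.ofReal (1 / κ * D) := by
        rw [← ENNReal.ofReal_mul (by positivity)]
        congr 1
        field_simp

lemma exists_le_mul_logScale {r a : ℝ} (hr : 1 ≤ r) (ha : 0 ≤ a) :
    ∃ C : ℝ, 0 < C ∧ ∀ (k : ℕ) (s : ℝ), 0 ≤ s → phiLog r a s ≤ 2 * 16 ^ k →
      s ≤ C * logScale r a k := by
  have hr0 : 0 < r := by linarith
  obtain ⟨M, hM, hMk⟩ := exists_rpow_le_mul_logScale hr a
  obtain ⟨C, hC0, hCM, hC⟩ : ∃ C : ℝ, 0 < C ∧ M ≤ C ∧ 3 * (2 * r) ^ a ≤ C ^ r := by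
    have := (tendsto_rpow_atTop hr0).eventually_ge_atTop (3 * (2 * r) ^ a)
    obtain ⟨C, h1, h2, h3⟩ :=
      ((eventually_gt_atTop 0).and ((eventually_ge_atTop M).and this)).exists
    exact ⟨C, h1, h2, h3⟩
  refine ⟨C, hC0, fun k s hs h => ?_⟩
  by_contra! hlt
  have hsc := logScale_pos r a k
  have hT : (0 : ℝ) < 16 ^ k := by positivity
  have hk : (0 : ℝ) ≤ k := k.cast_nonneg
  have hlog : ((k : ℝ) + 1) / (2 * r) ≤ Real.log (Real.exp 1 + C * logScale r a k) := by
    have h1 : 1 ≤ Real.log (Real.exp 1 + C * logScale r a k) := by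
      rw [Real.le_log_iff_exp_le (by positivity)]
      have : 0 < C * logScale r a k := by positivity
      linarith
    have h2 : k / r ≤ Real.log (Real.exp 1 + C * logScale r a k) := by
      calc k / r ≤ Real.log (((16 : ℝ) ^ k) ^ (1 / (2 * r))) := by
            rw [Real.log_rpow hT, Real.log_pow]
            have : (2 : ℝ) ≤ Real.log 16 := by
              rw [show (16 : ℝ) = 2 ^ 4 by norm_num, Real.log_pow]
              have := Real.log_two_gt_d9
              push_cast
              linarith
            calc k / r = 1 / (2 * r) * (k * 2) := by field_simp
              _ ≤ _ := by gcongr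
        _ ≤ _ := by
            apply Real.log_le_log (by positivity)
            calc _ ≤ M * logScale r a k := hMk k
              _ ≤ C * logScale r a k := by gcongr
              _ ≤ _ := le_add_of_nonneg_left (Real.exp_pos 1).le
    have h3 : ((k : ℝ) + 1) / (2 * r) ≤ (1 + k / r) / 2 := by
      rw [div_le_div_iff₀ (by positivity) (by norm_num)]
      have : k / r * r = k := div_mul_cancel₀ _ hr0.ne'
      nlinarith
    linarith
  have hbig : 3 * 16 ^ k ≤ phiLog r a (C * logScale r a k) := by
    calc 3 * (16 : ℝ) ^ k = 3 * (2 * r) ^ a * (16 ^ k * ((k : ℝ) + 1) ^ (-a)) *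
          (((k : ℝ) + 1) / (2 * r)) ^ a := by
          rw [Real.div_rpow (by positivity) (by positivity), Real.rpow_neg (by positivity)]
          field_simp
      _ ≤ C ^ r * (16 ^ k * ((k : ℝ) + 1) ^ (-a)) *
          Real.log (Real.exp 1 + C * logScale r a k) ^ a := by gcongr
      _ = phiLog r a (C * logScale r a k) := by
          unfold phiLog
          rw [Real.mul_rpow hC0.le hsc.le, logScale_rpow, div_self hr0.ne', Real.rpow_one,
            mul_div_cancel_right₀ _ hr0.ne']
  have := phiLog_mono hr0.le ha (by positivity) hlt.le
  linarith

theorem bumpI_spike_eq_top {p q a b : ℝ} (hpq : p.HolderConjugate q) (ha : 0 ≤ a) (hb : 0 ≤ b)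
    (hab : a / p + b / q = 3) :
    bumpI (phiLog p a) (phiLog q b) ((Set.Ico (0 : ℝ) 1).indicator fun _ => 1)
      (fun x => spikeSeq ⌊x⌋₊) = ⊤ := by
  obtain ⟨C, hC, hA⟩ := exists_le_mul_logScale hpq.lt.le ha
  obtain ⟨C', hC', hB⟩ := exists_le_mul_logScale hpq.symm.lt.le hb
  have key : ∀ k : ℕ, ENNReal.ofReal (((k : ℝ) + 1) ^ (1 / 2 : ℝ) / (C * C')) ≤
      bumpI (phiLog p a) (phiLog q b) ((Set.Ico (0 : ℝ) 1).indicator fun _ => 1)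
        (fun x => spikeSeq ⌊x⌋₊) := by
    intro k
    have hT : (1 : ℝ) ≤ 16 ^ k := one_le_pow₀ (by norm_num)
    have hsA := logScale_pos p a k
    have hsB := logScale_pos q b k
    have hL := spikeHeight_pos k
    have hvol : volume (Set.Ioc (0 : ℝ) (2 * 16 ^ k)) = ENNReal.ofReal (2 * 16 ^ k) := by
      rw [Real.volume_Ioc, sub_zero]
    have hfin : ∀ z : ℝ, ENNReal.ofReal z ≤ volume (Set.Ioc (0 : ℝ) (2 * 16 ^ k)) →
        z ≤ 2 * 16 ^ k := fun z hz => by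
      rw [hvol] at hz
      exact (ENNReal.ofReal_le_ofReal_iff (by positivity)).1 hz
    have h1 : ENNReal.ofReal (1 / (C * logScale p a k)) ≤
        luxNorm1 (phiLog p a) (Set.Ioc 0 (2 * 16 ^ k))
          ((Set.Ico (0 : ℝ) 1).indicator fun _ => 1) := by
      apply le_luxNorm1 (S := Set.Ioo 0 1) (y := 1) measurableSet_Ioo
      · intro z hz
        exact ⟨hz.1, by linarith [hz.2]⟩
      · simp
      · intro z hz
        exact Set.indicator_of_mem (Set.Ioo_subset_Ico_self hz) _
      · intro c hc h
        rw [abs_one] at h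
        have := hA k _ (by positivity) (hfin _ h)
        rw [div_le_iff₀ hc] at this
        rw [div_le_iff₀ (by positivity)]
        linarith
    have h2 : ENNReal.ofReal (spikeHeight k / (C' * logScale q b k)) ≤
        luxNorm1 (phiLog q b) (Set.Ioc 0 (2 * 16 ^ k)) (fun x => spikeSeq ⌊x⌋₊) := by
      apply le_luxNorm1 (S := Set.Ico (16 ^ k) (16 ^ k + 1)) (y := spikeHeight k)
        measurableSet_Ico
      · intro z hz
        exact ⟨by linarith [hz.1], by linarith [hz.2]⟩
      · simp
      · intro z hz
        have : ⌊z⌋₊ = 16 ^ k := by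
          rw [Nat.floor_eq_iff' (by positivity)]
          push_cast
          exact hz
        simp only [this, spikeSeq_pow]
      · intro c hc h
        rw [abs_of_pos hL] at h
        have := hB k _ (by positivity) (hfin _ h)
        rw [div_le_iff₀ hc] at this
        rw [div_le_iff₀ (by positivity)]
        linarith
    have hprod : logScale p a k * logScale q b k =
        spikeHeight k / ((k : ℝ) + 1) ^ (1 / 2 : ℝ) := by
      have hℓ : (0 : ℝ) < (k : ℝ) + 1 := by positivity
      have hconj := hpq.inv_add_inv_eq_one
      calc logScale p a k * logScale q b k
          = ((16 : ℝ) ^ k) ^ (1 / p + 1 / q) * ((k : ℝ) + 1) ^ (-(a / p) + -(b / q)) := by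
            rw [Real.rpow_add (by positivity), Real.rpow_add hℓ, logScale, logScale]
            ring
        _ = 16 ^ k * ((k : ℝ) + 1) ^ (-(5 / 2 : ℝ) + -(1 / 2 : ℝ)) := by
            rw [one_div, one_div, hconj, Real.rpow_one, ← neg_add, hab]
            norm_num
        _ = spikeHeight k / ((k : ℝ) + 1) ^ (1 / 2 : ℝ) := by
            rw [Real.rpow_add hℓ, Real.rpow_neg hℓ.le, Real.rpow_neg hℓ.le, spikeHeight]
            field_simp
    calc ENNReal.ofReal (((k : ℝ) + 1) ^ (1 / 2 : ℝ) / (C * C'))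
        = ENNReal.ofReal (1 / (C * logScale p a k)) *
            ENNReal.ofReal (spikeHeight k / (C' * logScale q b k)) := by
          rw [← ENNReal.ofReal_mul (by positivity)]
          congr 1
          calc ((k : ℝ) + 1) ^ (1 / 2 : ℝ) / (C * C')
              = spikeHeight k / (C * C' * (spikeHeight k / ((k : ℝ) + 1) ^ (1 / 2 : ℝ))) := by
                field_simp
            _ = _ := by rw [← hprod]; field_simp
      _ ≤ _ := mul_le_mul' h1 h2
      _ ≤ _ := by
          unfold bumpI
          exact le_iSup₂_of_le 0 (2 * 16 ^ k)
            (le_iSup_of_le (show (0 : ℝ) < 2 * 16 ^ k by positivity) le_rfl)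
  have ht : Tendsto (fun k : ℕ => ((k : ℝ) + 1) ^ (1 / 2 : ℝ) / (C * C')) atTop atTop :=
    ((tendsto_rpow_atTop (by norm_num)).comp
      (tendsto_atTop_add_const_right _ _ tendsto_natCast_atTop_atTop)).atTop_div_const
        (by positivity)
  exact top_le_iff.1 (le_of_tendsto' (ENNReal.tendsto_ofReal_nhds_top.2 ht) key)

lemma isWeight1_of_le_one {w : ℝ → ℝ} (hm : Measurable w) (h0 : ∀ x, 0 ≤ w x)
    (h1 : ∀ x, w x ≤ 1) : IsWeight1 w := by
  refine ⟨hm, h0, (locallyIntegrable_const (1 : ℝ)).mono hm.aestronglyMeasurable ?_⟩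
  exact ae_of_all _ fun x => by simpa [abs_of_nonneg (h0 x)] using h1 x

/-- **Theorem (example separating the joint bump condition from the two separated
bump conditions).** -/
theorem separated_bumps_do_not_imply_joint_bump (p : ℝ) (hp : 1 < p) :
    ∃ u v : ℝ → ℝ, IsWeight1 u ∧ IsWeight1 v ∧
      bumpI (phiLog p (p - 1 / 2)) (phiLog (p / (p - 1)) (2 * (p / (p - 1)) - 1 / 2))
          (fun x => u x ^ (1 / p)) (fun x => v x ^ (-(1 / p))) < ⊤ ∧
      bumpI (phiLog p (2 * p - 1 / 2)) (phiLog (p / (p - 1)) (p / (p - 1) - 1 / 2))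
          (fun x => u x ^ (1 / p)) (fun x => v x ^ (-(1 / p))) < ⊤ ∧
      bumpI (phiLog p (2 * p - 1)) (phiLog (p / (p - 1)) (2 * (p / (p - 1)) - 1))
          (fun x => u x ^ (1 / p)) (fun x => v x ^ (-(1 / p))) = ⊤ := by
  have hpq : p.HolderConjugate (p / (p - 1)) := Real.HolderConjugate.conjExponent hp
  set q := p / (p - 1)
  have hq : 1 < q := hpq.symm.lt
  have hp0 : p ≠ 0 := by linarith
  have hq0 : q ≠ 0 := by linarith
  have hconj := hpq.inv_add_inv_eq_one
  have hu : (fun x => (Set.Ico (0 : ℝ) 1).indicator (fun _ => (1 : ℝ)) x ^ (1 / p)) =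
      (Set.Ico (0 : ℝ) 1).indicator fun _ => 1 := by
    funext x
    by_cases hx : x ∈ Set.Ico (0 : ℝ) 1
    · simp [Set.indicator_of_mem hx]
    · simp [Set.indicator_of_notMem hx, hp0]
  have hv : (fun x : ℝ => (spikeSeq ⌊x⌋₊ ^ (-p)) ^ (-(1 / p))) = fun x => spikeSeq ⌊x⌋₊ := by
    funext x
    rw [← Real.rpow_mul (by linarith [one_le_spikeSeq ⌊x⌋₊]), neg_mul_neg,
      mul_one_div_cancel hp0, Real.rpow_one]
  have hexp : ∀ m n s : ℝ,
      (m * p - s) / p + (n * q - s) / q = m + n - s * (p⁻¹ + q⁻¹) := by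
    intro m n s
    field_simp
    ring
  refine ⟨(Set.Ico (0 : ℝ) 1).indicator fun _ => 1, fun x => spikeSeq ⌊x⌋₊ ^ (-p), ?_, ?_, ?_⟩
  · exact isWeight1_of_le_one (measurable_const.indicator measurableSet_Ico)
      (Set.indicator_nonneg fun _ _ => zero_le_one)
      (fun x => Set.indicator_apply_le' (fun _ => le_rfl) fun _ => zero_le_one)
  · refine isWeight1_of_le_one
      ((measurable_of_countable fun n : ℕ => spikeSeq n ^ (-p)).comp Nat.measurable_floor)
      (fun x => ?_) (fun x => ?_)
    · exact Real.rpow_nonneg (by linarith [one_le_spikeSeq ⌊x⌋₊]) _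
    · exact Real.rpow_le_one_of_one_le_of_nonpos (one_le_spikeSeq _) (by linarith)
  · rw [hu, hv]
    refine ⟨bumpI_spike_lt_top hpq (by linarith) (by linarith) ?_,
      bumpI_spike_lt_top hpq (by linarith) (by linarith) ?_,
      bumpI_spike_eq_top hpq (by linarith) (by linarith) ?_⟩
    · have := hexp 1 2 (1 / 2)
      rw [hconj, one_mul] at this
      rw [this]; norm_num
    · have := hexp 2 1 (1 / 2)
      rw [hconj, one_mul] at this
      rw [this]; norm_num
    · have := hexp 2 2 1
      rw [hconj] at this
      rw [this]; norm_num

end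
end
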